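/- Let (W,S) be an irreducible Coxeter system with W infinite, let w ∈ W and let p ∈ ℕ with p ≥ 1. Then w is essential if and only if w^p is essential. -/

import Mathlib

/-!
Statement 2: Let (W,S) be an irreducible Coxeter system with W infinite, let w ∈ W and let
p ∈ ℕ with p ≥ 1. Then w is essential if and only if w^p is essential.
-/

noncomputable section

namespace CoxeterPaper

variable {B : Type*} {W : Type*} [Group W]

/-- The Coxeter graph of `M`: vertex set `B`, with `s, t` joined by an edge iff `m_{s,t} ≥ 3`
(where `m_{s,t} = ∞` is encoded by `M s t = 0`). -/
def coxeterGraph (M : CoxeterMatrix B) : SimpleGraph B :=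
  SimpleGraph.fromRel (fun s t => M s t = 0 ∨ 3 ≤ M s t)

/-- The standard parabolic subgroup `W_X`, generated by the simple reflections indexed by `X`. -/
def standardParabolic {M : CoxeterMatrix B} (cs : CoxeterSystem M W) (X : Set B) : Subgroup W :=
  Subgroup.closure (cs.simple '' X)

/-- A parabolic subgroup of `W`: a conjugate `w W_X w⁻¹` of a standard parabolic subgroup. -/
def IsParabolic {M : CoxeterMatrix B} (cs : CoxeterSystem M W) (P : Subgroup W) : Prop :=
  ∃ (w : W) (X : Set B), P = (standardParabolic cs X).map (MulAut.conj w).toMonoidHom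

/-- `w` is essential: it does not lie in any proper parabolic subgroup of `W`. -/
def IsEssential {M : CoxeterMatrix B} (cs : CoxeterSystem M W) (w : W) : Prop :=
  ∀ P : Subgroup W, IsParabolic cs P → P ≠ ⊤ → w ∉ P

open Module Polynomial.Chebyshev

/-- The entry `2 B(α_s, α_t)` of the generalized Cartan matrix of `M`. -/
def cartanCoeff (M : CoxeterMatrix B) (s t : B) : ℝ :=
  -(2 * if M s t = 0 then 1 else Real.cos (Real.pi / M s t))

/-- The simple root indexed by `s`, a basis vector of the geometric representation. -/
def simpleRoot (s : B) : B →₀ ℝ := Finsupp.single s 1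

/-- The simple coroot indexed by `s`: the linear form `v ↦ 2 B(α_s, v)`. -/
def simpleCoroot (M : CoxeterMatrix B) (s : B) : Dual ℝ (B →₀ ℝ) :=
  Finsupp.linearCombination ℝ (cartanCoeff M s)

lemma simpleCoroot_simpleRoot (M : CoxeterMatrix B) (s t : B) :
    simpleCoroot M s (simpleRoot t) = cartanCoeff M s t := by
  simp [simpleCoroot, simpleRoot]

lemma cartanCoeff_self (M : CoxeterMatrix B) (s : B) : cartanCoeff M s s = 2 := by
  simp [cartanCoeff]

lemma cartanCoeff_comm (M : CoxeterMatrix B) (s t : B) :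
    cartanCoeff M s t = cartanCoeff M t s := by
  simp [cartanCoeff, M.symmetric s t]

lemma simpleCoroot_simpleRoot_self (M : CoxeterMatrix B) (s : B) :
    simpleCoroot M s (simpleRoot s) = 2 := by
  rw [simpleCoroot_simpleRoot, cartanCoeff_self]

/-- The reflection of the geometric representation attached to `s`. -/
def simpleReflection (M : CoxeterMatrix B) (s : B) : (B →₀ ℝ) ≃ₗ[ℝ] (B →₀ ℝ) :=
  reflection (simpleCoroot_simpleRoot_self M s)

lemma two_le_of_ne {M : CoxeterMatrix B} {s t : B} (hst : s ≠ t) (h0 : M s t ≠ 0) :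
    2 ≤ M s t := by
  have := M.off_diagonal s t hst
  omega

lemma simpleReflection_isLiftable (M : CoxeterMatrix B) : M.IsLiftable (simpleReflection M) := by
  intro s t
  by_cases h0 : M s t = 0
  · simp [h0]
  by_cases hst : s = t
  · subst hst
    rw [M.diagonal, pow_one]
    ext1 v
    exact involutive_reflection (simpleCoroot_simpleRoot_self M s) v
  have h2 := two_le_of_ne hst h0
  have hc : cartanCoeff M s t = -(2 * Real.cos (Real.pi / M s t)) := by simp [cartanCoeff, h0]
  rcases h2.eq_or_lt with h2 | h3
  · have hz : cartanCoeff M s t = 0 := by rw [hc, ← h2]; simp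
    have hz' : cartanCoeff M t s = 0 := by rw [cartanCoeff_comm, hz]
    have hcomm : Commute (simpleReflection M s) (simpleReflection M t) := by
      ext1 v
      simp only [LinearEquiv.mul_apply, simpleReflection, reflection_apply, map_sub, map_smul,
        simpleCoroot_simpleRoot, hz, hz', zero_smul, sub_zero]
      abel
    rw [← h2, hcomm.mul_pow, pow_two, pow_two]
    have key (r : B) : simpleReflection M r * simpleReflection M r = 1 := by
      ext1 v
      exact involutive_reflection (simpleCoroot_simpleRoot_self M r) v
    rw [key, key, mul_one]
  · set m := M s t with hm
    set θ : ℝ := 2 * (Real.pi / m) with hθ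
    have hm0 : (m : ℝ) ≠ 0 := by exact_mod_cast h0
    have hmθ : m * θ = 2 * Real.pi := by rw [hθ]; field_simp
    have hm3 : (3 : ℝ) ≤ m := by exact_mod_cast h3
    have hsin : Real.sin θ ≠ 0 := by
      refine (Real.sin_pos_of_pos_of_lt_pi (by positivity) ?_).ne'
      have := Real.pi_pos
      nlinarith
    have ht : 2 * Real.cos θ = simpleCoroot M s (simpleRoot t) *
        simpleCoroot M t (simpleRoot s) - 2 := by
      rw [simpleCoroot_simpleRoot, simpleCoroot_simpleRoot, cartanCoeff_comm M t s, hc, hθ,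
        Real.cos_two_mul]
      ring
    apply LinearEquiv.toLinearMap_injective
    rw [simpleReflection, simpleReflection, reflection_mul_reflection_pow _ _ m _ ht]
    have hS (n : ℤ) : (S ℝ n).eval (2 * Real.cos θ) = Real.sin ((n + 1) * θ) / Real.sin θ := by
      rw [eq_div_iff hsin, S_two_mul_real_cos]
    rcases Nat.even_or_odd' m with ⟨k, hk | hk⟩
    · have e1 : ((m : ℤ) - 2) / 2 = k - 1 := by omega
      have e2 : ((m : ℤ) - 1) / 2 = k - 1 := by omega
      have hz : (S ℝ ((k : ℤ) - 1)).eval (2 * Real.cos θ) = 0 := by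
        have : (k : ℝ) * θ = Real.pi := by
          have : (m : ℝ) = 2 * k := by exact_mod_cast hk
          rw [this] at hmθ
          linarith
        rw [hS]
        push_cast
        rw [sub_add_cancel, this]
        simp
      rw [e1, e2, hz]
      simp only [zero_mul, zero_smul, add_zero]
      rfl
    · have e1 : ((m : ℤ) - 2) / 2 = k - 1 := by omega
      have e2 : ((m : ℤ) - 1) / 2 = k := by omega
      have e3 : ((m : ℤ) - 3) / 2 = k - 1 := by omega
      have e4 : (m : ℤ) / 2 = k := by omega
      have hz : (S ℝ (k : ℤ)).eval (2 * Real.cos θ) +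
          (S ℝ ((k : ℤ) - 1)).eval (2 * Real.cos θ) = 0 := by
        have : ((k : ℝ) + 1) * θ = 2 * Real.pi - k * θ := by
          have : (m : ℝ) = 2 * k + 1 := by exact_mod_cast hk
          rw [this] at hmθ
          linarith
        rw [hS, hS]
        push_cast
        rw [sub_add_cancel, this, Real.sin_two_pi_sub]
        ring
      rw [e1, e2, e3, e4, hz]
      simp only [mul_zero, zero_smul, add_zero]
      rfl

variable {M : CoxeterMatrix B} (cs : CoxeterSystem M W)

/-- The geometric representation of a Coxeter system. -/
def geomRep : Representation ℝ W (B →₀ ℝ) :=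
  (LinearEquiv.automorphismGroup.toLinearMapMonoidHom).comp
    (cs.lift ⟨simpleReflection M, simpleReflection_isLiftable M⟩)

lemma geomRep_simple (s : B) (v : B →₀ ℝ) :
    geomRep cs (cs.simple s) v = v - simpleCoroot M s v • simpleRoot s := by
  simp only [geomRep, MonoidHom.comp_apply, cs.lift_apply_simple]
  exact reflection_apply v (simpleCoroot_simpleRoot_self M s)

lemma geomRep_simple_simpleRoot (s : B) :
    geomRep cs (cs.simple s) (simpleRoot s) = -simpleRoot s := by
  rw [geomRep_simple, simpleCoroot_simpleRoot_self, two_smul]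
  abel

lemma geomRep_mul_apply (g h : W) (v : B →₀ ℝ) :
    geomRep cs (g * h) v = geomRep cs g (geomRep cs h v) := by
  rw [map_mul]; rfl

lemma geomRep_inv_apply_self (g : W) (v : B →₀ ℝ) : geomRep cs g⁻¹ (geomRep cs g v) = v := by
  rw [← geomRep_mul_apply]; simp

lemma geomRep_apply_inv_self (g : W) (v : B →₀ ℝ) : geomRep cs g (geomRep cs g⁻¹ v) = v := by
  rw [← geomRep_mul_apply]; simp

/-- The invariant symmetric bilinear form of the geometric representation, scaled so that
simple roots have square length `2`. -/
def geomForm (M : CoxeterMatrix B) : (B →₀ ℝ) →ₗ[ℝ] Dual ℝ (B →₀ ℝ) :=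
  Finsupp.linearCombination ℝ (simpleCoroot M)

lemma geomForm_simpleRoot_left (s : B) (v : B →₀ ℝ) :
    geomForm M (simpleRoot s) v = simpleCoroot M s v := by
  simp [geomForm, simpleRoot]

lemma geomForm_simpleRoot_right (v : B →₀ ℝ) (s : B) :
    geomForm M v (simpleRoot s) = simpleCoroot M s v := by
  induction v using Finsupp.induction_linear with
  | zero => simp
  | add f g hf hg => simp [hf, hg]
  | single t c =>
    have : Finsupp.single t c = c • simpleRoot t := by simp [simpleRoot]
    rw [this, map_smul, map_smul, LinearMap.smul_apply, geomForm_simpleRoot_left,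
      simpleCoroot_simpleRoot, simpleCoroot_simpleRoot, cartanCoeff_comm]

lemma geomForm_geomRep (g : W) (v w : B →₀ ℝ) :
    geomForm M (geomRep cs g v) (geomRep cs g w) = geomForm M v w := by
  induction g using cs.simple_induction_left generalizing v w with
  | one => simp
  | mul_simple_left g s ih =>
    rw [geomRep_mul_apply, geomRep_mul_apply, ← ih v w, geomRep_simple, geomRep_simple]
    simp only [map_sub, map_smul, LinearMap.sub_apply, LinearMap.smul_apply, smul_eq_mul,
      geomForm_simpleRoot_left, geomForm_simpleRoot_right, simpleCoroot_simpleRoot_self]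
    ring

lemma geomRep_alternatingWord_simpleRoot (s t : B) (k : ℕ) :
    geomRep cs (cs.wordProd (CoxeterSystem.alternatingWord s t k)) (simpleRoot s) =
      (S ℝ (k : ℤ)).eval (-cartanCoeff M s t) • simpleRoot (if Even k then s else t) +
      (S ℝ ((k : ℤ) - 1)).eval (-cartanCoeff M s t) • simpleRoot (if Even k then t else s) := by
  induction k with
  | zero => simp [CoxeterSystem.alternatingWord]
  | succ k ih =>
    have hrec : (S ℝ ((k + 1 : ℕ) : ℤ)).eval (-cartanCoeff M s t) =
        -cartanCoeff M s t * (S ℝ (k : ℤ)).eval (-cartanCoeff M s t) -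
          (S ℝ ((k : ℤ) - 1)).eval (-cartanCoeff M s t) := by
      rw [Nat.cast_succ, S_add_one]
      simp
    rw [CoxeterSystem.alternatingWord_succ', cs.wordProd_cons, geomRep_mul_apply, ih, hrec]
    have e : ((k + 1 : ℕ) : ℤ) - 1 = k := by simp
    rw [e]
    by_cases hk : Even k
    · simp only [hk, Nat.even_add_one, if_true, not_true_eq_false, if_false, map_add, map_smul,
        geomRep_simple, simpleCoroot_simpleRoot, cartanCoeff_self, cartanCoeff_comm M t s]
      module
    · simp only [hk, Nat.even_add_one, if_true, not_false_eq_true, if_false, map_add, map_smul,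
        geomRep_simple, simpleCoroot_simpleRoot, cartanCoeff_self]
      module

lemma eval_S_neg_cartanCoeff_nonneg {s t : B} (hst : s ≠ t) {k : ℤ} (hk : -1 ≤ k)
    (hkM : M s t ≠ 0 → k < M s t) : 0 ≤ (S ℝ k).eval (-cartanCoeff M s t) := by
  have hk' : (0 : ℝ) ≤ k + 1 := by exact_mod_cast (by omega : 0 ≤ k + 1)
  by_cases h0 : M s t = 0
  · simpa [cartanCoeff, h0] using hk'
  have h2 : (2 : ℝ) ≤ M s t := by exact_mod_cast two_le_of_ne hst h0
  have hlt : (k : ℝ) + 1 ≤ M s t := by exact_mod_cast hkM h0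
  have hpi := Real.pi_pos
  have hpos : 0 < Real.sin (Real.pi / M s t) := by
    refine Real.sin_pos_of_pos_of_lt_pi (by positivity) ?_
    rw [div_lt_iff₀ (by linarith)]
    nlinarith
  have h := S_two_mul_real_cos (Real.pi / M s t) k
  have hnum : 0 ≤ Real.sin ((k + 1) * (Real.pi / M s t)) := by
    refine Real.sin_nonneg_of_nonneg_of_le_pi (by positivity) ?_
    rw [← mul_div_assoc, div_le_iff₀ (by linarith)]
    nlinarith
  rw [cartanCoeff, if_neg h0, neg_neg]
  exact nonneg_of_mul_nonneg_left (h ▸ hnum) hpos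

lemma simpleRoot_nonneg (s : B) : 0 ≤ simpleRoot s := by simp [simpleRoot]

theorem geomRep_simpleRoot_nonneg {w : W} {s : B} (hs : ¬cs.IsRightDescent w s) :
    0 ≤ geomRep cs w (simpleRoot s) := by
  induction hn : cs.length w using Nat.strong_induction_on generalizing w s with
  | _ n ih =>
  subst hn
  by_cases hw : w = 1
  · simpa [hw] using simpleRoot_nonneg s
  obtain ⟨t, ht⟩ := cs.exists_rightDescent_of_ne_one hw
  have hst : s ≠ t := fun h ↦ hs (h ▸ ht)
  set a : ℕ → W := fun k ↦ cs.wordProd (CoxeterSystem.alternatingWord s t k) with ha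
  have ha_succ (k : ℕ) : w * (a (k + 1))⁻¹ =
      w * (a k)⁻¹ * cs.simple (if Even k then t else s) := by
    simp only [ha, CoxeterSystem.alternatingWord_succ', cs.wordProd_cons, mul_inv_rev,
      cs.inv_simple, mul_assoc]
  obtain ⟨k, hk, hk'⟩ : ∃ k, cs.length (w * (a (k + 1))⁻¹) + (k + 1) = cs.length w ∧
      cs.length (w * (a (k + 2))⁻¹) + (k + 2) ≠ cs.length w := by
    by_contra! hcon
    have hall (k : ℕ) : cs.length (w * (a (k + 1))⁻¹) + (k + 1) = cs.length w := by
      induction k with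
      | zero => simpa [ha, CoxeterSystem.alternatingWord] using cs.isRightDescent_iff.1 ht
      | succ k ihk => exact hcon k ihk
    have := hall (cs.length w)
    omega
  set v := w * (a (k + 1))⁻¹ with hv
  have hwv : w = v * a (k + 1) := by simp [hv]
  have hdesc' : ¬cs.IsRightDescent v (if Even (k + 1) then t else s) := by
    rw [cs.isRightDescent_iff, ← ha_succ]
    intro h
    exact hk' (by rw [← hk, ← h]; ring)
  have hdesc : ¬cs.IsRightDescent v (if Even (k + 1) then s else t) := by
    have e : (if Even (k + 1) then s else t) = if Even k then t else s := by
      by_cases hk : Even k <;> simp [hk, Nat.even_add_one]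
    rw [CoxeterSystem.IsRightDescent, e, hv, ha_succ, cs.simple_mul_simple_cancel_right,
      ← ha_succ, ← hv]
    have h1 := cs.length_mul_le (w * (a k)⁻¹) (a k)
    have h2 := cs.length_wordProd_le (CoxeterSystem.alternatingWord s t k)
    rw [CoxeterSystem.length_alternatingWord] at h2
    rw [inv_mul_cancel_right] at h1
    change cs.length (a k) ≤ k at h2
    omega
  have hkM : M s t ≠ 0 → ((k + 1 : ℕ) : ℤ) < M s t := by
    intro h0
    by_contra! hle
    have hle' : M t s < k + 2 := by rw [M.symmetric t s]; omega
    have hnr := cs.not_isReduced_alternatingWord t s (by rwa [M.symmetric t s]) hle'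
    have hlen := cs.length_wordProd_le (CoxeterSystem.alternatingWord t s (k + 2))
    rw [CoxeterSystem.IsReduced] at hnr
    rw [CoxeterSystem.length_alternatingWord] at hnr hlen
    have heq : w * cs.simple s =
        v * cs.wordProd (CoxeterSystem.alternatingWord t s (k + 2)) := by
      rw [CoxeterSystem.alternatingWord_succ t s, cs.wordProd_concat, ← mul_assoc, hwv]
    have h1 := cs.length_mul_le v (cs.wordProd (CoxeterSystem.alternatingWord t s (k + 2)))
    rw [← heq] at h1
    have h2 := cs.not_isRightDescent_iff.1 hs
    omega
  rw [hwv, geomRep_mul_apply, geomRep_alternatingWord_simpleRoot, map_add, map_smul, map_smul]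
  exact add_nonneg
    (smul_nonneg (eval_S_neg_cartanCoeff_nonneg hst (by omega) hkM)
      (ih _ (by omega) hdesc rfl))
    (smul_nonneg (eval_S_neg_cartanCoeff_nonneg hst (by omega) fun h ↦ by have := hkM h; omega)
      (ih _ (by omega) hdesc' rfl))

theorem geomRep_simpleRoot_nonpos {w : W} {s : B} (hs : cs.IsRightDescent w s) :
    geomRep cs w (simpleRoot s) ≤ 0 := by
  have h := geomRep_simpleRoot_nonneg cs (cs.isRightDescent_iff_not_isRightDescent_mul.1 hs)
  rwa [geomRep_mul_apply, geomRep_simple_simpleRoot, map_neg, Left.nonneg_neg_iff] at h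

/-- The root system of the geometric representation. -/
def roots : Set (B →₀ ℝ) := {β | ∃ w s, β = geomRep cs w (simpleRoot s)}

lemma simpleRoot_mem_roots (s : B) : simpleRoot s ∈ roots cs := ⟨1, s, by simp⟩

variable {cs} in
lemma geomRep_mem_roots (g : W) {β : B →₀ ℝ} (hβ : β ∈ roots cs) :
    geomRep cs g β ∈ roots cs := by
  obtain ⟨w, s, rfl⟩ := hβ
  exact ⟨g * w, s, (geomRep_mul_apply cs g w _).symm⟩

variable {cs} in
lemma neg_mem_roots {β : B →₀ ℝ} (hβ : β ∈ roots cs) : -β ∈ roots cs := by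
  obtain ⟨w, s, rfl⟩ := hβ
  exact ⟨w * cs.simple s, s, by rw [geomRep_mul_apply, geomRep_simple_simpleRoot, map_neg]⟩

variable {cs} in
lemma nonneg_or_nonpos_of_mem_roots {β : B →₀ ℝ} (hβ : β ∈ roots cs) : 0 ≤ β ∨ β ≤ 0 := by
  obtain ⟨w, s, rfl⟩ := hβ
  by_cases hs : cs.IsRightDescent w s
  · exact .inr (geomRep_simpleRoot_nonpos cs hs)
  · exact .inl (geomRep_simpleRoot_nonneg cs hs)

variable {cs} in
lemma geomForm_self_of_mem_roots {β : B →₀ ℝ} (hβ : β ∈ roots cs) : geomForm M β β = 2 := by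
  obtain ⟨w, s, rfl⟩ := hβ
  rw [geomForm_geomRep, geomForm_simpleRoot_left, simpleCoroot_simpleRoot_self]

variable {cs} in
lemma eq_simpleRoot_of_geomRep_simple_nonpos {β : B →₀ ℝ} (hβ : β ∈ roots cs) (h0 : 0 ≤ β)
    {s : B} (hs : geomRep cs (cs.simple s) β ≤ 0) : β = simpleRoot s := by
  have hmul : β = β s • simpleRoot s := by
    ext t
    by_cases hts : s = t
    · simp [simpleRoot, hts]
    · have h := hs t
      rw [geomRep_simple] at h
      simp only [simpleRoot, Finsupp.coe_sub, Finsupp.coe_smul, Pi.sub_apply, Pi.smul_apply,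
        Finsupp.single_eq_of_ne' hts, smul_eq_mul, mul_zero, sub_zero, Finsupp.coe_zero,
        Pi.zero_apply] at h ⊢
      exact le_antisymm h (h0 t)
  have hsq := geomForm_self_of_mem_roots hβ
  rw [hmul] at hsq
  simp only [map_smul, LinearMap.smul_apply, geomForm_simpleRoot_left,
    simpleCoroot_simpleRoot_self, smul_eq_mul] at hsq
  have hc : 0 ≤ β s := h0 s
  have h1 : β s = 1 := by nlinarith
  rw [hmul, h1, one_smul]

lemma dual_geomRep_apply (g : W) (f : Dual ℝ (B →₀ ℝ)) (v : B →₀ ℝ) :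
    (geomRep cs).dual g f v = f (geomRep cs g⁻¹ v) := rfl

lemma dual_geomRep_mul_apply (g h : W) (f : Dual ℝ (B →₀ ℝ)) :
    (geomRep cs).dual (g * h) f = (geomRep cs).dual g ((geomRep cs).dual h f) := by
  rw [map_mul]; rfl

lemma dual_geomRep_one_apply (f : Dual ℝ (B →₀ ℝ)) : (geomRep cs).dual 1 f = f := by
  rw [map_one]; rfl

lemma dual_geomRep_inv_apply_self (g : W) (f : Dual ℝ (B →₀ ℝ)) :
    (geomRep cs).dual g⁻¹ ((geomRep cs).dual g f) = f := by
  rw [← dual_geomRep_mul_apply, inv_mul_cancel, dual_geomRep_one_apply]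

lemma dual_geomRep_simple_eq_self_iff (s : B) (f : Dual ℝ (B →₀ ℝ)) :
    (geomRep cs).dual (cs.simple s) f = f ↔ f (simpleRoot s) = 0 := by
  constructor
  · intro h
    have h' := LinearMap.congr_fun h (simpleRoot s)
    rw [dual_geomRep_apply, cs.inv_simple, geomRep_simple_simpleRoot, map_neg] at h'
    linarith
  · intro h
    refine LinearMap.ext fun v ↦ ?_
    rw [dual_geomRep_apply, cs.inv_simple, geomRep_simple, map_sub, map_smul, h, smul_zero,
      sub_zero]

lemma dual_ext_simpleRoot {f f' : Dual ℝ (B →₀ ℝ)}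
    (h : ∀ s, f (simpleRoot s) = f' (simpleRoot s)) : f = f' :=
  Finsupp.lhom_ext' fun s ↦ LinearMap.ext_ring (h s)

/-- The positive roots on which the linear form `f` is negative. -/
def negativeRoots (f : Dual ℝ (B →₀ ℝ)) : Set (B →₀ ℝ) := {β ∈ roots cs | 0 ≤ β ∧ f β < 0}

/-- The linear form `f` lies in the Tits cone: it is negative on only finitely many
positive roots. -/
def InTitsCone (f : Dual ℝ (B →₀ ℝ)) : Prop := (negativeRoots cs f).Finite

/-- The linear form `f` lies in the closed fundamental chamber. -/
def IsDominant (f : Dual ℝ (B →₀ ℝ)) : Prop := ∀ s, 0 ≤ f (simpleRoot s)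

lemma IsDominant.apply_nonneg {f : Dual ℝ (B →₀ ℝ)} (hf : IsDominant f) {v : B →₀ ℝ}
    (hv : 0 ≤ v) : 0 ≤ f v := by
  have : v = v.sum fun s c ↦ c • simpleRoot s := by simp [simpleRoot]
  rw [this, Finsupp.sum, map_sum]
  exact Finset.sum_nonneg fun s _ ↦ by
    rw [map_smul]
    exact mul_nonneg (hv s) (hf s)

lemma IsDominant.inTitsCone {f : Dual ℝ (B →₀ ℝ)} (hf : IsDominant f) : InTitsCone cs f := by
  have : negativeRoots cs f = ∅ :=
    Set.eq_empty_of_forall_notMem fun β hβ ↦ (hf.apply_nonneg hβ.2.1).not_gt hβ.2.2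
  rw [InTitsCone, this]
  exact Set.finite_empty

variable {cs} in
lemma InTitsCone.sum {ι : Type*} {f : ι → Dual ℝ (B →₀ ℝ)} (I : Finset ι)
    (hf : ∀ i ∈ I, InTitsCone cs (f i)) : InTitsCone cs (∑ i ∈ I, f i) := by
  refine (I.finite_toSet.biUnion hf).subset fun β ⟨hβ, h0, hlt⟩ ↦ ?_
  rw [LinearMap.sum_apply] at hlt
  obtain ⟨i, hi, hi'⟩ := Finset.exists_lt_of_sum_lt (by simpa using hlt :
    ∑ i ∈ I, f i β < ∑ i ∈ I, 0)
  exact Set.mem_biUnion hi ⟨hβ, h0, hi'⟩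

variable {cs} in
lemma InTitsCone.dual_apply {f : Dual ℝ (B →₀ ℝ)} (hf : InTitsCone cs f) (g : W) :
    InTitsCone cs ((geomRep cs).dual g f) := by
  induction g using cs.simple_induction_left with
  | one => rwa [dual_geomRep_one_apply]
  | mul_simple_left g s ih =>
    rw [dual_geomRep_mul_apply]
    refine ((ih.image (geomRep cs (cs.simple s))).union
      (Set.finite_singleton (simpleRoot s))).subset fun β ⟨hβ, h0, hlt⟩ ↦ ?_
    rw [dual_geomRep_apply, cs.inv_simple] at hlt
    rcases nonneg_or_nonpos_of_mem_roots (geomRep_mem_roots (cs.simple s) hβ) with h | h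
    · refine .inl ⟨_, ⟨geomRep_mem_roots _ hβ, h, hlt⟩, ?_⟩
      rw [← geomRep_mul_apply, cs.simple_mul_simple_self, map_one]
      rfl
    · exact .inr (eq_simpleRoot_of_geomRep_simple_nonpos hβ h0 h)

variable {cs} in
lemma InTitsCone.exists_isDominant {f : Dual ℝ (B →₀ ℝ)} (hf : InTitsCone cs f) :
    ∃ g, IsDominant ((geomRep cs).dual g f) := by
  induction hn : (negativeRoots cs f).ncard using Nat.strong_induction_on generalizing f with
  | _ n ih =>
  subst hn
  by_cases hdom : IsDominant f
  · exact ⟨1, by rwa [dual_geomRep_one_apply]⟩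
  obtain ⟨s, hs⟩ : ∃ s, f (simpleRoot s) < 0 := by simpa [IsDominant] using hdom
  have hmaps : geomRep cs (cs.simple s) '' negativeRoots cs ((geomRep cs).dual (cs.simple s) f) ⊂
      negativeRoots cs f := by
    refine (Set.ssubset_iff_of_subset ?_).2
      ⟨simpleRoot s, ⟨simpleRoot_mem_roots cs s, simpleRoot_nonneg s, hs⟩, ?_⟩
    · rintro _ ⟨β, ⟨hβ, h0, hlt⟩, rfl⟩
      rw [dual_geomRep_apply, cs.inv_simple] at hlt
      refine ⟨geomRep_mem_roots _ hβ, ?_, hlt⟩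
      refine (nonneg_or_nonpos_of_mem_roots (geomRep_mem_roots _ hβ)).resolve_right fun h ↦ ?_
      rw [eq_simpleRoot_of_geomRep_simple_nonpos hβ h0 h, geomRep_simple_simpleRoot,
        map_neg] at hlt
      linarith
    · rintro ⟨β, ⟨_, h0, hlt⟩, hβs⟩
      have hβ := geomRep_inv_apply_self cs (cs.simple s) β
      rw [hβs, cs.inv_simple, geomRep_simple_simpleRoot] at hβ
      have := h0 s
      rw [← hβ] at this
      simp only [simpleRoot, Finsupp.coe_neg, Pi.neg_apply, Finsupp.single_eq_same,
        Finsupp.coe_zero, Pi.zero_apply] at this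
      linarith
  have hcard := Set.ncard_lt_ncard hmaps hf
  rw [Set.ncard_image_of_injective _ (Function.LeftInverse.injective
    (geomRep_inv_apply_self cs (cs.simple s)))] at hcard
  obtain ⟨g, hg⟩ := ih _ hcard (hf.dual_apply _) rfl
  exact ⟨g * cs.simple s, by rwa [dual_geomRep_mul_apply]⟩

variable {cs} in
lemma IsDominant.mem_standardParabolic {f : Dual ℝ (B →₀ ℝ)} (hf : IsDominant f) {g : W}
    (hg : (geomRep cs).dual g f = f) :
    g ∈ standardParabolic cs {s | f (simpleRoot s) = 0} := by
  induction hn : cs.length g using Nat.strong_induction_on generalizing g with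
  | _ n ih =>
  subst hn
  by_cases h1 : g = 1
  · exact h1 ▸ one_mem _
  obtain ⟨s, hs⟩ := cs.exists_leftDescent_of_ne_one h1
  have hs0 : f (simpleRoot s) = 0 := by
    refine le_antisymm ?_ (hf s)
    rw [← hg, dual_geomRep_apply]
    have h := geomRep_simpleRoot_nonpos cs (cs.isRightDescent_inv_iff.2 hs)
    have := hf.apply_nonneg (neg_nonneg.2 h)
    rw [map_neg] at this
    linarith
  have hfix : (geomRep cs).dual (cs.simple s * g) f = f := by
    rw [dual_geomRep_mul_apply, hg, (dual_geomRep_simple_eq_self_iff cs s f).2 hs0]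
  rw [← cs.simple_mul_simple_cancel_left (w := g) s]
  exact mul_mem (Subgroup.subset_closure ⟨s, hs0, rfl⟩) (ih _ hs hfix rfl)

lemma dual_apply_eq_self_of_mem_standardParabolic {X : Set B} {f : Dual ℝ (B →₀ ℝ)}
    (hf : ∀ s ∈ X, f (simpleRoot s) = 0) {g : W} (hg : g ∈ standardParabolic cs X) :
    (geomRep cs).dual g f = f := by
  induction hg using Subgroup.closure_induction with
  | mem x hx =>
    obtain ⟨s, hs, rfl⟩ := hx
    exact (dual_geomRep_simple_eq_self_iff cs s f).2 (hf s hs)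
  | one => exact dual_geomRep_one_apply cs f
  | mul x y _ _ hx hy => rw [dual_geomRep_mul_apply, hy, hx]
  | inv x _ hx =>
    nth_rw 1 [← hx]
    exact dual_geomRep_inv_apply_self cs x f

lemma eq_one_of_geomRep_simpleRoot {g : W}
    (hg : ∀ s, geomRep cs g (simpleRoot s) = simpleRoot s) : g = 1 := by
  by_contra h1
  obtain ⟨s, hs⟩ := cs.exists_rightDescent_of_ne_one h1
  have h := geomRep_simpleRoot_nonpos cs hs s
  rw [hg] at h
  simp only [simpleRoot, Finsupp.single_eq_same, Finsupp.coe_zero, Pi.zero_apply] at h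
  linarith

lemma infinite_roots [Finite B] [Infinite W] : (roots cs).Infinite := by
  intro hfin
  have : Finite (roots cs) := hfin
  let φ : W → B → roots cs := fun w s ↦ ⟨geomRep cs w (simpleRoot s), w, s, rfl⟩
  refine not_injective_infinite_finite φ fun w w' h ↦ ?_
  rw [← inv_mul_eq_one]
  refine eq_one_of_geomRep_simpleRoot cs fun s ↦ ?_
  have hs : geomRep cs w (simpleRoot s) = geomRep cs w' (simpleRoot s) :=
    congrArg Subtype.val (congrFun h s)
  rw [geomRep_mul_apply, ← hs, geomRep_inv_apply_self]

/-- The subspace of linear forms that vanish on all but finitely many roots. -/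
def cofiniteVanishing : Submodule ℝ (Dual ℝ (B →₀ ℝ)) where
  carrier := {f | {β ∈ roots cs | f β ≠ 0}.Finite}
  zero_mem' := by simp
  add_mem' {f f'} hf hf' := by
    refine (hf.union hf').subset fun β ⟨hβ, h⟩ ↦ ?_
    by_cases h0 : f β = 0
    · exact .inr ⟨hβ, by simpa [h0] using h⟩
    · exact .inl ⟨hβ, h0⟩
  smul_mem' c f hf := hf.subset fun β ⟨hβ, h⟩ ↦ ⟨hβ, fun h0 ↦ h (by simp [h0])⟩

variable {cs} in
lemma dual_mem_cofiniteVanishing (g : W) {f : Dual ℝ (B →₀ ℝ)}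
    (hf : f ∈ cofiniteVanishing cs) : (geomRep cs).dual g f ∈ cofiniteVanishing cs := by
  refine (hf.image (geomRep cs g)).subset fun β ⟨hβ, h⟩ ↦ ?_
  exact ⟨geomRep cs g⁻¹ β, ⟨geomRep_mem_roots _ hβ, h⟩, geomRep_apply_inv_self cs g β⟩

lemma cartanCoeff_ne_zero_of_adj {s t : B} (h : (coxeterGraph M).Adj s t) :
    cartanCoeff M s t ≠ 0 := by
  obtain ⟨-, h⟩ := h
  have h : M s t = 0 ∨ 3 ≤ M s t := by
    rcases h with h | h
    · exact h
    · rwa [M.symmetric s t]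
  by_cases h0 : M s t = 0
  · simp [cartanCoeff, h0]
  have h3 : (3 : ℝ) ≤ M s t := by exact_mod_cast h.resolve_left h0
  have hpi := Real.pi_pos
  have : 0 < Real.cos (Real.pi / M s t) := by
    refine Real.cos_pos_of_mem_Ioo ⟨(neg_neg_of_pos (by positivity)).trans (by positivity), ?_⟩
    rw [div_lt_iff₀ (by linarith)]
    nlinarith
  simp only [cartanCoeff, if_neg h0]
  exact (neg_neg_of_pos (by linarith)).ne

lemma cofiniteVanishing_eq_bot [Finite B] [Infinite W] (hirr : (coxeterGraph M).Connected) :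
    cofiniteVanishing cs = ⊥ := by
  rw [Submodule.eq_bot_iff]
  intro f hf
  have hann : ∃ s, ∀ y ∈ cofiniteVanishing cs, y (simpleRoot s) = 0 := by
    by_contra! hcon
    have hsep (β : B →₀ ℝ) (hβ : β ∈ roots cs) : ∃ y ∈ cofiniteVanishing cs, y β ≠ 0 := by
      obtain ⟨w, s, rfl⟩ := hβ
      obtain ⟨y, hy, hys⟩ := hcon s
      refine ⟨_, dual_mem_cofiniteVanishing w hy, ?_⟩
      rwa [dual_geomRep_apply, geomRep_inv_apply_self]
    obtain ⟨G, hG⟩ := IsNoetherian.noetherian (cofiniteVanishing cs)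
    refine infinite_roots cs ((G.finite_toSet.biUnion (t := fun y ↦ {β ∈ roots cs | y β ≠ 0})
      fun y hy ↦ ?_).subset fun β hβ ↦ ?_)
    · have : y ∈ cofiniteVanishing cs := hG ▸ Submodule.subset_span hy
      exact this
    · by_contra hnot
      simp only [Set.mem_iUnion, not_exists] at hnot
      obtain ⟨y, hy, hyβ⟩ := hsep β hβ
      refine hyβ ?_
      rw [← hG] at hy
      have hle : Submodule.span ℝ (G : Set (Dual ℝ (B →₀ ℝ))) ≤
          LinearMap.ker (Dual.eval ℝ (B →₀ ℝ) β) := Submodule.span_le.2 fun z hz ↦ by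
        by_contra hne
        exact hnot z hz ⟨hβ, hne⟩
      exact hle hy
  obtain ⟨s, hs⟩ := hann
  have hadj {r t : B} (hrt : (coxeterGraph M).Adj r t)
      (hr : ∀ y ∈ cofiniteVanishing cs, y (simpleRoot r) = 0) :
      ∀ y ∈ cofiniteVanishing cs, y (simpleRoot t) = 0 := by
    intro y hy
    have h := hr _ (dual_mem_cofiniteVanishing (cs.simple t) hy)
    rw [dual_geomRep_apply, cs.inv_simple, geomRep_simple, simpleCoroot_simpleRoot, map_sub,
      map_smul, hr y hy, zero_sub, neg_eq_zero, smul_eq_mul] at h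
    exact (mul_eq_zero.1 h).resolve_left (cartanCoeff_ne_zero_of_adj hrt.symm)
  have hall (t : B) : ∀ y ∈ cofiniteVanishing cs, y (simpleRoot t) = 0 := by
    obtain ⟨p⟩ := hirr.preconnected s t
    induction p with
    | nil => exact hs
    | cons h _ ih => exact ih (hadj h hs)
  exact dual_ext_simpleRoot fun t ↦ by simpa using hall t f hf

variable {cs} in
/-- The Tits cone of an infinite irreducible Coxeter group contains no line. -/
theorem InTitsCone.eq_zero [Finite B] [Infinite W] (hirr : (coxeterGraph M).Connected)
    {f : Dual ℝ (B →₀ ℝ)} (hf : InTitsCone cs f) (hf' : InTitsCone cs (-f)) : f = 0 := by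
  rw [← Submodule.mem_bot ℝ, ← cofiniteVanishing_eq_bot cs hirr]
  have hpos := hf.union hf'
  refine (hpos.union (hpos.image Neg.neg)).subset fun β ⟨hβ, hne⟩ ↦ ?_
  have key (γ : B →₀ ℝ) (hγ : γ ∈ roots cs) (h0 : 0 ≤ γ) (hne : f γ ≠ 0) :
      γ ∈ negativeRoots cs f ∪ negativeRoots cs (-f) := by
    rcases hne.lt_or_gt with h | h
    · exact .inl ⟨hγ, h0, h⟩
    · exact .inr ⟨hγ, h0, by simpa using h⟩
  rcases nonneg_or_nonpos_of_mem_roots hβ with h | h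
  · exact .inl (key β hβ h hne)
  · exact .inr ⟨-β, key _ (neg_mem_roots hβ) (neg_nonneg.2 h) (by simpa using hne), neg_neg β⟩

variable {cs} in
lemma InTitsCone.exists_isParabolic {f : Dual ℝ (B →₀ ℝ)} (hf : InTitsCone cs f) (hne : f ≠ 0) :
    ∃ P, IsParabolic cs P ∧ P ≠ ⊤ ∧ ∀ w, (geomRep cs).dual w f = f → w ∈ P := by
  obtain ⟨g, hg⟩ := hf.exists_isDominant
  have hback := dual_geomRep_inv_apply_self cs g f
  set z := (geomRep cs).dual g f with hz
  refine ⟨_, ⟨g⁻¹, {s | z (simpleRoot s) = 0}, rfl⟩, fun htop ↦ hne ?_, fun w hw ↦ ?_⟩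
  · rw [← hback]
    suffices z = 0 by simp [this]
    refine dual_ext_simpleRoot fun s ↦ ?_
    have hs : g⁻¹ * cs.simple s * g ∈ (⊤ : Subgroup W) := Subgroup.mem_top _
    rw [← htop] at hs
    obtain ⟨x, hx, hxs⟩ := hs
    have : x = cs.simple s := by simpa using hxs
    subst this
    have := dual_apply_eq_self_of_mem_standardParabolic cs (f := z) (fun _ h ↦ h) hx
    simpa using (dual_geomRep_simple_eq_self_iff cs s z).1 this
  · refine ⟨g * w * g⁻¹, hg.mem_standardParabolic ?_, by simp [mul_assoc]⟩
    rw [dual_geomRep_mul_apply, hback, dual_geomRep_mul_apply, hw]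

lemma IsParabolic.exists_fixed {P : Subgroup W} (hP : IsParabolic cs P) (htop : P ≠ ⊤) :
    ∃ f, InTitsCone cs f ∧ f ≠ 0 ∧ ∀ w ∈ P, (geomRep cs).dual w f = f := by
  classical
  obtain ⟨g, X, rfl⟩ := hP
  obtain ⟨r, hr⟩ : ∃ r, r ∉ X := by
    by_contra! hX
    apply htop
    rw [Set.eq_univ_of_forall hX, standardParabolic, Set.image_univ,
      cs.subgroup_closure_range_simple]
    exact Subgroup.map_top_of_surjective _ (MulAut.conj g).surjective
  let x : Dual ℝ (B →₀ ℝ) := Finsupp.linearCombination ℝ fun s ↦ if s ∈ X then (0 : ℝ) else 1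
  have hx (s : B) : x (simpleRoot s) = if s ∈ X then (0 : ℝ) else 1 := by
    simp [x, simpleRoot]
  have hdom : IsDominant x := fun s ↦ by rw [hx]; split_ifs <;> norm_num
  have hback := dual_geomRep_inv_apply_self cs g x
  refine ⟨(geomRep cs).dual g x, (hdom.inTitsCone cs).dual_apply g, fun h ↦ ?_, ?_⟩
  · rw [h, map_zero] at hback
    have := hx r
    rw [← hback, if_neg hr] at this
    simp at this
  · rintro _ ⟨w, hw, rfl⟩
    change (geomRep cs).dual (g * w * g⁻¹) _ = _
    rw [dual_geomRep_mul_apply, hback, dual_geomRep_mul_apply,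
      dual_apply_eq_self_of_mem_standardParabolic cs (fun s hs ↦ by rw [hx, if_pos hs]) hw]

variable {cs} in
/-- If `w ^ p` fixes a nonzero point of the Tits cone, then so does `w`: sum the translates of
that point under `1, w, …, w ^ (p - 1)`. -/
lemma exists_fixed_of_pow_fixed [Finite B] [Infinite W] (hirr : (coxeterGraph M).Connected)
    {w : W} {p : ℕ} (hp : 1 ≤ p) {f : Dual ℝ (B →₀ ℝ)} (hf : InTitsCone cs f) (hne : f ≠ 0)
    (hfix : (geomRep cs).dual (w ^ p) f = f) :
    ∃ y, InTitsCone cs y ∧ y ≠ 0 ∧ (geomRep cs).dual w y = y := by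
  obtain ⟨q, rfl⟩ := Nat.exists_eq_add_of_le' hp
  refine ⟨∑ i ∈ Finset.range (q + 1), (geomRep cs).dual (w ^ i) f,
    InTitsCone.sum _ fun i _ ↦ hf.dual_apply _, fun h0 ↦ hne ?_, ?_⟩
  · refine hf.eq_zero hirr ?_
    rw [Finset.sum_range_succ', pow_zero, map_one, Module.End.one_apply] at h0
    rw [← eq_neg_of_add_eq_zero_left h0]
    exact InTitsCone.sum _ fun i _ ↦ hf.dual_apply _
  · rw [map_sum]
    simp only [← dual_geomRep_mul_apply, ← pow_succ']
    rw [Finset.sum_range_succ, Finset.sum_range_succ', hfix, pow_zero,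
      dual_geomRep_one_apply]

/-- In an irreducible Coxeter system with `W` infinite, `w` is essential
iff `w^p` is essential, for every `p ≥ 1`. -/
theorem essential_pow_iff [Fintype B] {M : CoxeterMatrix B} (cs : CoxeterSystem M W)
    (hirr : (coxeterGraph M).Connected) (hinf : Infinite W)
    (w : W) (p : ℕ) (hp : 1 ≤ p) :
    IsEssential cs w ↔ IsEssential cs (w ^ p) := by
  constructor
  · intro hw P hP htop hmem
    obtain ⟨f, hf, hne, hfix⟩ := hP.exists_fixed cs htop
    obtain ⟨y, hy, hy0, hwy⟩ := exists_fixed_of_pow_fixed hirr hp hf hne (hfix _ hmem)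
    obtain ⟨Q, hQ, hQtop, hQmem⟩ := hy.exists_isParabolic hy0
    exact hw Q hQ hQtop (hQmem w hwy)
  · exact fun hw P hP htop hmem ↦ hw P hP htop (pow_mem hmem p)

end CoxeterPaper
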